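/- arXiv:hep-th/9612032 — 2 statements merged into one kernel-verified Lean document; each statement's English description precedes it below -/
import Mathlib

section
/- Dong's Lemma (Lemma 3.2): let a, b, c be weak vertex operators on V such that each of the pairs (a,b), (a,c) and (b,c) is mutually local of some order. Then for every integer n the residue product a·ₙb and c are mutually local of some order. -/
/-!
Dong's Lemma (Lemma 3.2): if the pairs `(a,b)`, `(a,c)`, `(b,c)` of weak vertex
operators are mutually local, then `a·ₙb` and `c` are mutually local.
-/

variable {R V : Type*} [CommRing R] [AddCommGroup V] [Module R V]

/-- A weak vertex operator on `V`. -/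
def IsWeakVertexOperator (a : ℤ → Module.End R V) : Prop :=
  ∀ w : V, ∃ N : ℤ, ∀ n : ℤ, N ≤ n → a n w = 0

/-- The `n`-th residue product of two weak vertex operators, applied to a vector:
`(a·ₙb)ₘ w = ∑_{i=0}^∞ (-1)^i C(n,i) (a_{n-i}(b_{m+i} w) - (-1)^n b_{n+m-i}(a_i w))`. -/
noncomputable def resProd (a b : ℤ → Module.End R V) (n m : ℤ) (w : V) : V :=
  ∑ᶠ i : ℕ, ((-1 : ℤ) ^ i * Ring.choose n i) •
    (a (n - i) (b (m + i) w) - (n.negOnePow : ℤ) • b (n + m - i) (a i w))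

/-- Two operator families are mutually local of order `N`: the coefficient form of
`(z₁-z₂)^N x(z₁) y(z₂) = (z₁-z₂)^N y(z₂) x(z₁)`. -/
def IsMutuallyLocal (x y : ℤ → V → V) (N : ℕ) : Prop :=
  ∀ p q : ℤ, ∀ w : V,
    ∑ i ∈ Finset.range (N + 1), ((-1 : ℤ) ^ i * (N.choose i : ℤ)) •
      (x (p + N - i) (y (q + i) w) - y (q + i) (x (p + N - i) w)) = 0

/-- Translation of functions on `G` by `g`. -/
def shiftEnd {G : Type*} (V : Type*) [AddCommGroup G] [AddCommGroup V] (g : G) :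
    Module.End ℤ (G → V) where
  toFun F x := F (x + g)
  map_add' _ _ := rfl
  map_smul' _ _ := rfl

section Shift

variable {G W : Type*} [AddCommGroup G] [AddCommGroup W]

@[simp]
theorem shiftEnd_apply (g : G) (F : G → W) (x : G) : shiftEnd W g F x = F (x + g) := rfl

theorem shiftEnd_commute (g h : G) : Commute (shiftEnd W g) (shiftEnd W h) := by
  refine LinearMap.ext fun F => funext fun x => ?_
  simp [Module.End.mul_apply, add_right_comm]

theorem shiftEnd_sub_commute (g h g' h' : G) :
    Commute (shiftEnd W g - shiftEnd W h) (shiftEnd W g' - shiftEnd W h') :=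
  ((shiftEnd_commute g g').sub_right (shiftEnd_commute g h')).sub_left
    ((shiftEnd_commute h g').sub_right (shiftEnd_commute h h'))

theorem shiftEnd_pow_apply (g : G) (n : ℕ) (F : G → W) (x : G) :
    (shiftEnd W g ^ n) F x = F (x + (n : ℤ) • g) := by
  induction n generalizing x with
  | zero => simp
  | succ n ih =>
    rw [pow_succ', Module.End.mul_apply, shiftEnd_apply, ih]
    congr 1
    push_cast
    module

/-- The binomial expansion of a power of a difference of two translations. -/
theorem shiftEnd_sub_pow_apply (g h : G) (N : ℕ) (F : G → W) (x : G) :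
    ((shiftEnd W g - shiftEnd W h) ^ N) F x =
      ∑ i ∈ Finset.range (N + 1), ((-1 : ℤ) ^ i * (N.choose i : ℤ)) •
        F (x + ((N : ℤ) - i) • g + (i : ℤ) • h) := by
  have hcomm : Commute (-shiftEnd W h) (shiftEnd W g) := (shiftEnd_commute h g).neg_left
  rw [sub_eq_neg_add, hcomm.add_pow, LinearMap.sum_apply,
    Finset.sum_apply]
  refine Finset.sum_congr rfl fun i hi => ?_
  have hi' : i ≤ N := Nat.lt_succ_iff.mp (Finset.mem_range.mp hi)
  have hneg : (-shiftEnd W h) ^ i = (-1 : ℤ) ^ i • shiftEnd W h ^ i := by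
    rw [neg_pow]
    rcases Nat.even_or_odd i with hev | hod
    · simp [hev.neg_one_pow]
    · simp [hod.neg_one_pow]
  rw [hneg, ← nsmul_eq_mul', LinearMap.smul_apply, Pi.smul_apply, smul_mul_assoc,
    LinearMap.smul_apply, Pi.smul_apply, Module.End.mul_apply, shiftEnd_pow_apply,
    shiftEnd_pow_apply, ← natCast_zsmul, smul_smul, mul_comm, Nat.cast_sub hi']
  congr 2
  abel

/-- `F` vanishes far along every ray in the direction `d`. -/
def EventuallyZeroAlong (d : G) (F : G → W) : Prop :=
  ∀ x, ∃ I : ℕ, ∀ i : ℕ, I ≤ i → F (x + (i : ℤ) • d) = 0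

theorem EventuallyZeroAlong.sub {d : G} {F F' : G → W} (hF : EventuallyZeroAlong d F)
    (hF' : EventuallyZeroAlong d F') : EventuallyZeroAlong d (F - F') := by
  intro x
  obtain ⟨I, hI⟩ := hF x
  obtain ⟨J, hJ⟩ := hF' x
  refine ⟨max I J, fun i hi => ?_⟩
  rw [Pi.sub_apply, hI i (le_of_max_le_left hi), hJ i (le_of_max_le_right hi), sub_zero]

theorem EventuallyZeroAlong.shiftEnd {d : G} {F : G → W} (hF : EventuallyZeroAlong d F) (g : G) :
    EventuallyZeroAlong d (shiftEnd W g F) := by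
  intro x
  obtain ⟨I, hI⟩ := hF (x + g)
  exact ⟨I, fun i hi => by rw [shiftEnd_apply, add_right_comm, hI i hi]⟩

/-- The operator `(S_g - S_h)^n`, `n ∈ ℤ`, on functions on `G`, where `S` denotes translation,
expanded in nonnegative powers of `S_h`. -/
noncomputable def binomExpand (g h : G) (n : ℤ) (F : G → W) (x : G) : W :=
  ∑ᶠ i : ℕ, ((-1 : ℤ) ^ i * Ring.choose n i) • F (x + (n - i) • g + (i : ℤ) • h)

theorem binomExpand_zero_exponent (g h : G) (F : G → W) : binomExpand g h 0 F = F := by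
  funext x
  rw [binomExpand, finsum_eq_single _ 0]
  · simp
  · intro i hi
    rw [Ring.choose_zero_pos ℤ (Nat.pos_of_ne_zero hi)]
    simp

@[simp]
theorem binomExpand_zero (g h : G) (n : ℤ) : binomExpand g h n (0 : G → W) = 0 := by
  funext x
  simp [binomExpand]

theorem EventuallyZeroAlong.exists_expansion_eq_zero {g h : G} {F : G → W}
    (hF : EventuallyZeroAlong (h - g) F) (n : ℤ) (x : G) :
    ∃ I : ℕ, ∀ i : ℕ, I ≤ i → F (x + (n - i) • g + (i : ℤ) • h) = 0 := by
  obtain ⟨I, hI⟩ := hF (x + n • g)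
  refine ⟨I, fun i hi => ?_⟩
  rw [← hI i hi]
  congr 1
  module

theorem finsum_zsmul_eq_sum_range {f : ℕ → W} {I : ℕ} (hf : ∀ i, I ≤ i → f i = 0)
    (r : ℕ → ℤ) : ∑ᶠ i, r i • f i = ∑ i ∈ Finset.range I, r i • f i := by
  refine finsum_eq_sum_of_support_subset _ fun i hi => ?_
  by_contra hlt
  refine hi ?_
  simp only [Finset.coe_range, Set.mem_Iio, not_lt] at hlt
  simp [hf i hlt]

theorem finite_support_zsmul {f : ℕ → W} {I : ℕ} (hf : ∀ i, I ≤ i → f i = 0)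
    (r : ℕ → ℤ) : (Function.support fun i => r i • f i).Finite := by
  refine (Set.finite_Iio I).subset fun i hi => ?_
  by_contra hlt
  exact hi (by simp [hf i (not_lt.mp hlt)])

theorem binomExpand_sub {g h : G} {F F' : G → W} (hF : EventuallyZeroAlong (h - g) F)
    (hF' : EventuallyZeroAlong (h - g) F') (n : ℤ) :
    binomExpand g h n (F - F') = binomExpand g h n F - binomExpand g h n F' := by
  funext x
  obtain ⟨I, hI⟩ := hF.exists_expansion_eq_zero n x
  obtain ⟨J, hJ⟩ := hF'.exists_expansion_eq_zero n x
  simp only [binomExpand, Pi.sub_apply, smul_sub]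
  exact finsum_sub_distrib (finite_support_zsmul hI _) (finite_support_zsmul hJ _)

theorem binomExpand_shiftEnd (g h : G) (n : ℤ) (u : G) (F : G → W) :
    binomExpand g h n (shiftEnd W u F) = shiftEnd W u (binomExpand g h n F) := by
  funext x
  simp only [binomExpand, shiftEnd_apply]
  refine finsum_congr fun i => ?_
  congr 2
  abel

theorem EventuallyZeroAlong.shiftEnd_sub_pow {d : G} {F : G → W} (hF : EventuallyZeroAlong d F)
    (u v : G) (N : ℕ) :
    EventuallyZeroAlong d (((_root_.shiftEnd W u - _root_.shiftEnd W v) ^ N) F) := by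
  induction N with
  | zero => simpa using hF
  | succ N ih =>
    rw [pow_succ', Module.End.mul_apply, LinearMap.sub_apply]
    exact (ih.shiftEnd u).sub (ih.shiftEnd v)

theorem binomExpand_shiftEnd_sub_pow {g h : G} {F : G → W}
    (hF : EventuallyZeroAlong (h - g) F) (n : ℤ) (u v : G) (N : ℕ) :
    binomExpand g h n (((shiftEnd W u - shiftEnd W v) ^ N) F) =
      ((shiftEnd W u - shiftEnd W v) ^ N) (binomExpand g h n F) := by
  induction N with
  | zero => simp
  | succ N ih =>
    have hN := hF.shiftEnd_sub_pow u v N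
    rw [pow_succ', Module.End.mul_apply, Module.End.mul_apply, LinearMap.sub_apply,
      LinearMap.sub_apply, binomExpand_sub (hN.shiftEnd u) (hN.shiftEnd v),
      binomExpand_shiftEnd, binomExpand_shiftEnd, ih]

/-- Pascal's rule for `binomExpand`. -/
theorem shiftEnd_sub_binomExpand {g h : G} {F : G → W}
    (hF : EventuallyZeroAlong (h - g) F) (n : ℤ) :
    (shiftEnd W g - shiftEnd W h) (binomExpand g h n F) = binomExpand g h (n + 1) F := by
  funext x
  obtain ⟨I, hI⟩ := hF.exists_expansion_eq_zero (n + 1) x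
  set f : ℕ → W := fun i => F (x + (n + 1 - i) • g + (i : ℤ) • h) with hf
  have hg : binomExpand g h n F (x + g) =
      ∑ᶠ i : ℕ, ((-1 : ℤ) ^ i * Ring.choose n i) • f i := by
    refine finsum_congr fun i => ?_
    simp only [hf]
    congr 2
    module
  have hh : binomExpand g h n F (x + h) =
      ∑ᶠ i : ℕ, ((-1 : ℤ) ^ i * Ring.choose n i) • f (i + 1) := by
    refine finsum_congr fun i => ?_
    simp only [hf]
    congr 2
    push_cast
    module
  have hsucc : binomExpand g h (n + 1) F x =
      ∑ᶠ i : ℕ, ((-1 : ℤ) ^ i * Ring.choose (n + 1) i) • f i := rfl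
  have hI' : ∀ i, I + 1 ≤ i → f i = 0 := fun i hi => hI i (by omega)
  rw [LinearMap.sub_apply, Pi.sub_apply, shiftEnd_apply, shiftEnd_apply, hg, hh, hsucc,
    finsum_zsmul_eq_sum_range hI', finsum_zsmul_eq_sum_range hI',
    finsum_zsmul_eq_sum_range (I := I) (f := fun i => f (i + 1)) (fun i hi => hI' _ (by omega)),
    Finset.sum_range_succ', Finset.sum_range_succ' _ I, add_sub_right_comm,
    ← Finset.sum_sub_distrib]
  congr 1
  · refine Finset.sum_congr rfl fun i _ => ?_
    rw [Ring.choose_succ_succ, ← sub_smul]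
    congr 1
    ring
  · simp

end Shift

theorem Module.End.pow_sub_apply_eq_zero {S M : Type*} [Ring S] [AddCommGroup M] [Module S M]
    {f g : Module.End S M} (hfg : Commute f g) {x : M} {s t : ℕ} (hf : (f ^ s) x = 0)
    (hg : (g ^ t) x = 0) : ((f - g) ^ (s + t)) x = 0 := by
  have hg' : ((-g) ^ t) x = 0 := by
    rw [neg_pow, Module.End.mul_apply, hg, map_zero]
  rw [sub_eq_add_neg, hfg.neg_right.add_pow, LinearMap.sum_apply]
  refine Finset.sum_eq_zero fun i _ => ?_
  rw [← nsmul_eq_mul', LinearMap.smul_apply]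
  rcases le_total s i with hs | hs
  · rw [(hfg.neg_right.pow_pow _ _).eq, Module.End.mul_apply, Module.End.pow_map_zero_of_le hs hf]
    simp
  · rw [Module.End.mul_apply,
      Module.End.pow_map_zero_of_le (show t ≤ s + t - i by omega) hg']
    simp

/-- The abstract form of Dong's lemma: `A` and `B` play the roles of the commutators
`[a(z₁)b(z₂), c(z₃)]` and `[b(z₂)a(z₁), c(z₃)]`, and the translations by `e₁`, `e₂`, `e₃` those
of multiplication by `z₁`, `z₂`, `z₃`. -/
theorem shiftEnd_sub_pow_eq_zero {G W : Type*} [AddCommGroup G] [AddCommGroup W]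
    {e₁ e₂ e₃ : G} {A B : G → W} (hA : EventuallyZeroAlong (e₂ - e₁) A)
    (hB : EventuallyZeroAlong (e₁ - e₂) B) {N N₁ N₂ : ℕ}
    (hAB : ((shiftEnd W e₁ - shiftEnd W e₂) ^ N) (A - B) = 0)
    (hA0 : ((shiftEnd W e₁ - shiftEnd W e₃) ^ N₁)
      (((shiftEnd W e₂ - shiftEnd W e₃) ^ N₂) A) = 0)
    (hB0 : ((shiftEnd W e₁ - shiftEnd W e₃) ^ N₁)
      (((shiftEnd W e₂ - shiftEnd W e₃) ^ N₂) B) = 0) (n : ℤ) :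
    ((shiftEnd W e₂ - shiftEnd W e₃) ^ (N₂ + (N₁ + (N + (-n).toNat))))
      (binomExpand e₁ e₂ n A - (n.negOnePow : ℤ) • binomExpand e₂ e₁ n B) = 0 := by
  set D : ℤ → G → W := fun n =>
    binomExpand e₁ e₂ n A - (n.negOnePow : ℤ) • binomExpand e₂ e₁ n B with hD
  have hstep : ∀ n, (shiftEnd W e₁ - shiftEnd W e₂) (D n) = D (n + 1) := by
    intro n
    simp only [hD]
    rw [map_sub, map_smul, shiftEnd_sub_binomExpand hA, ← shiftEnd_sub_binomExpand hB,
      Int.negOnePow_succ, ← neg_sub (shiftEnd W e₂), LinearMap.neg_apply]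
    simp only [Units.val_neg, neg_smul, smul_neg]
  have hpow : ∀ (L : ℕ) n, ((shiftEnd W e₁ - shiftEnd W e₂) ^ L) (D n) = D (n + L) := by
    intro L n
    induction L with
    | zero => simp
    | succ L ih =>
      rw [pow_succ', Module.End.mul_apply, ih, hstep]
      push_cast
      rw [add_assoc]
  have hzero : D 0 = A - B := by simp [hD, binomExpand_zero_exponent]
  have hγ : ((shiftEnd W e₁ - shiftEnd W e₂) ^ (N + (-n).toNat)) (D n) = 0 := by
    have hn : n + ((N + (-n).toNat : ℕ) : ℤ) = 0 + ((N + n.toNat : ℕ) : ℤ) := by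
      push_cast
      omega
    rw [hpow, hn, ← hpow, hzero]
    exact Module.End.pow_map_zero_of_le (Nat.le_add_right _ _) hAB
  have hαβ : ((shiftEnd W e₁ - shiftEnd W e₃) ^ N₁)
      (((shiftEnd W e₂ - shiftEnd W e₃) ^ N₂) (D n)) = 0 := by
    simp only [hD]
    rw [map_sub, map_smul, map_sub, map_smul, ← binomExpand_shiftEnd_sub_pow hA,
      ← binomExpand_shiftEnd_sub_pow (hA.shiftEnd_sub_pow _ _ _),
      ← binomExpand_shiftEnd_sub_pow hB,
      ← binomExpand_shiftEnd_sub_pow (hB.shiftEnd_sub_pow _ _ _), hA0, hB0]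
    simp
  have hγβ : ((shiftEnd W e₁ - shiftEnd W e₂) ^ (N + (-n).toNat))
      (((shiftEnd W e₂ - shiftEnd W e₃) ^ N₂) (D n)) = 0 := by
    rw [← Module.End.mul_apply, ((shiftEnd_sub_commute e₁ e₂ e₂ e₃).pow_pow _ _).eq,
      Module.End.mul_apply, hγ, map_zero]
  have key := Module.End.pow_sub_apply_eq_zero (shiftEnd_sub_commute e₁ e₃ e₁ e₂) hαβ hγβ
  rw [sub_sub_sub_cancel_left, ← Module.End.mul_apply, ← pow_add,
    add_comm _ N₂] at key
  exact key

/-- A linear image of the residue product, as a difference of two one-sided expansions. -/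
theorem map_resProd {a b : ℤ → Module.End R V} (ha : IsWeakVertexOperator a)
    (hb : IsWeakVertexOperator b) (f : Module.End R V) (n m : ℤ) (w : V) :
    f (resProd a b n m w) =
      ∑ᶠ i : ℕ, ((-1 : ℤ) ^ i * Ring.choose n i) • f (a (n - i) (b (m + i) w)) -
        (n.negOnePow : ℤ) •
          ∑ᶠ i : ℕ, ((-1 : ℤ) ^ i * Ring.choose n i) • f (b (n + m - i) (a i w)) := by
  obtain ⟨I, hI⟩ := ha w
  obtain ⟨J, hJ⟩ := hb w
  have h₁ : ∀ i : ℕ, (J - m).toNat ≤ i → a (n - i) (b (m + i) w) = 0 := fun i hi => by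
    rw [hJ _ (by omega), map_zero]
  have h₂ : ∀ i : ℕ, I.toNat ≤ i → b (n + m - i) (a i w) = 0 := fun i hi => by
    rw [hI _ (by omega), map_zero]
  have h₃ : ∀ i : ℕ, max (J - m).toNat I.toNat ≤ i →
      a (n - i) (b (m + i) w) - (n.negOnePow : ℤ) • b (n + m - i) (a i w) = 0 := fun i hi => by
    rw [h₁ i (le_of_max_le_left hi), h₂ i (le_of_max_le_right hi), smul_zero, sub_zero]
  have h₄ : ∀ i : ℕ, (J - m).toNat ≤ i → f (a (n - i) (b (m + i) w)) = 0 := fun i hi => by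
    rw [h₁ i hi, map_zero]
  have h₅ : ∀ i : ℕ, I.toNat ≤ i → f (b (n + m - i) (a i w)) = 0 := fun i hi => by
    rw [h₂ i hi, map_zero]
  have h₆ : ∀ i : ℕ, I.toNat ≤ i → (n.negOnePow : ℤ) • f (b (n + m - i) (a i w)) = 0 :=
    fun i hi => by rw [h₅ i hi, smul_zero]
  rw [smul_finsum' _ (finite_support_zsmul h₅ _), resProd, ← LinearMap.toAddMonoidHom_coe,
    AddMonoidHom.map_finsum _ (finite_support_zsmul h₃ _)]
  simp only [LinearMap.toAddMonoidHom_coe, map_zsmul, map_sub, smul_sub]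
  rw [finsum_sub_distrib (finite_support_zsmul h₄ _) (finite_support_zsmul h₆ _)]
  simp only [smul_comm (n.negOnePow : ℤ)]

/-- The commutator of a residue product with `c` in terms of the expansions of the
three-variable commutators. -/
theorem resProd_commutator {a b : ℤ → Module.End R V} (ha : IsWeakVertexOperator a)
    (hb : IsWeakVertexOperator b) (c : ℤ → Module.End R V) (w : V) :
    ∃ A B : ℤ × ℤ × ℤ → V,
      (∀ i j k, A (i, j, k) = a i (b j (c k w)) - c k (a i (b j w))) ∧
      (∀ i j k, B (i, j, k) = b j (a i (c k w)) - c k (b j (a i w))) ∧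
      EventuallyZeroAlong ((0, 1, 0) - (1, 0, 0)) A ∧
      EventuallyZeroAlong ((1, 0, 0) - (0, 1, 0)) B ∧
      ∀ n m k : ℤ, resProd a b n m (c k w) - c k (resProd a b n m w) =
        (binomExpand (1, 0, 0) (0, 1, 0) n A -
          (n.negOnePow : ℤ) • binomExpand (0, 1, 0) (1, 0, 0) n B) (0, m, k) := by
  let A₁ : ℤ × ℤ × ℤ → V := fun x => a x.1 (b x.2.1 (c x.2.2 w))
  let A₂ : ℤ × ℤ × ℤ → V := fun x => c x.2.2 (a x.1 (b x.2.1 w))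
  let B₁ : ℤ × ℤ × ℤ → V := fun x => b x.2.1 (a x.1 (c x.2.2 w))
  let B₂ : ℤ × ℤ × ℤ → V := fun x => c x.2.2 (b x.2.1 (a x.1 w))
  have hA₁ : EventuallyZeroAlong ((0, 1, 0) - (1, 0, 0)) A₁ := by
    intro x
    obtain ⟨J, hJ⟩ := hb (c x.2.2 w)
    refine ⟨(J - x.2.1).toNat, fun i hi => ?_⟩
    simp [A₁, hJ (x.2.1 + i) (by omega)]
  have hA₂ : EventuallyZeroAlong ((0, 1, 0) - (1, 0, 0)) A₂ := by
    intro x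
    obtain ⟨J, hJ⟩ := hb w
    refine ⟨(J - x.2.1).toNat, fun i hi => ?_⟩
    simp [A₂, hJ (x.2.1 + i) (by omega)]
  have hB₁ : EventuallyZeroAlong ((1, 0, 0) - (0, 1, 0)) B₁ := by
    intro x
    obtain ⟨J, hJ⟩ := ha (c x.2.2 w)
    refine ⟨(J - x.1).toNat, fun i hi => ?_⟩
    simp [B₁, hJ (x.1 + i) (by omega)]
  have hB₂ : EventuallyZeroAlong ((1, 0, 0) - (0, 1, 0)) B₂ := by
    intro x
    obtain ⟨J, hJ⟩ := ha w
    refine ⟨(J - x.1).toNat, fun i hi => ?_⟩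
    simp [B₂, hJ (x.1 + i) (by omega)]
  refine ⟨A₁ - A₂, B₁ - B₂, fun _ _ _ => rfl, fun _ _ _ => rfl, hA₁.sub hA₂, hB₁.sub hB₂,
    fun n m k => ?_⟩
  have h₁ := map_resProd ha hb LinearMap.id n m (c k w)
  have h₂ := map_resProd ha hb (c k) n m w
  simp only [LinearMap.id_apply] at h₁
  rw [h₁, h₂, binomExpand_sub hA₁ hA₂, binomExpand_sub hB₁ hB₂, smul_sub]
  simp only [Pi.sub_apply, Pi.smul_apply]
  rw [sub_sub_sub_comm]
  simp [binomExpand, A₁, A₂, B₁, B₂, add_comm n m, add_sub_assoc]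

/-- `(z₁ - z₃)^N₁ (z₂ - z₃)^N₂` kills `[a(z₁)b(z₂), c(z₃)]`. -/
theorem shiftEnd_sub_pow_commutator_eq_zero {G : Type*} [AddCommGroup G]
    {a b c : ℤ → Module.End R V} {N₁ N₂ : ℕ}
    (hac : IsMutuallyLocal (fun m w => a m w) (fun m w => c m w) N₁)
    (hbc : IsMutuallyLocal (fun m w => b m w) (fun m w => c m w) N₂) (w : V)
    (φ : G → ℤ × ℤ × ℤ) {e₁ e₂ e₃ : G}
    (h₁ : ∀ x (s t : ℤ), φ (x + s • e₁ + t • e₃) = ((φ x).1 + s, (φ x).2.1, (φ x).2.2 + t))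
    (h₂ : ∀ x (s t : ℤ), φ (x + s • e₂ + t • e₃) = ((φ x).1, (φ x).2.1 + s, (φ x).2.2 + t))
    {A : G → V} (hA : ∀ x, A x = a (φ x).1 (b (φ x).2.1 (c (φ x).2.2 w)) -
      c (φ x).2.2 (a (φ x).1 (b (φ x).2.1 w))) :
    ((shiftEnd V e₁ - shiftEnd V e₃) ^ N₁) (((shiftEnd V e₂ - shiftEnd V e₃) ^ N₂) A) = 0 := by
  let A₁ : G → V := fun x => a (φ x).1
    (b (φ x).2.1 (c (φ x).2.2 w) - c (φ x).2.2 (b (φ x).2.1 w))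
  let A₂ : G → V := fun x => a (φ x).1 (c (φ x).2.2 (b (φ x).2.1 w)) -
    c (φ x).2.2 (a (φ x).1 (b (φ x).2.1 w))
  have hsum : A = A₁ + A₂ := by
    funext x
    simp [hA, A₁, A₂]
  have hA₁ : ((shiftEnd V e₂ - shiftEnd V e₃) ^ N₂) A₁ = 0 := by
    funext x
    rw [shiftEnd_sub_pow_apply]
    simp only [A₁, h₂, ← map_zsmul]
    rw [← map_sum]
    simp only [← add_sub_assoc]
    rw [hbc, map_zero, Pi.zero_apply]
  have hA₂ : ((shiftEnd V e₁ - shiftEnd V e₃) ^ N₁) A₂ = 0 := by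
    funext x
    rw [shiftEnd_sub_pow_apply]
    simp only [A₂, h₁, ← add_sub_assoc]
    exact hac _ _ _
  rw [hsum, map_add, hA₁, zero_add, ← Module.End.mul_apply,
    ((shiftEnd_sub_commute e₁ e₃ e₂ e₃).pow_pow _ _).eq, Module.End.mul_apply, hA₂, map_zero]

/-- **Dong's Lemma.** If `a`, `b`, `c` are pairwise mutually local weak vertex
operators, then for every integer `n` the residue product `a·ₙb` and `c` are
mutually local of some order. -/
theorem dong_lemma (a b c : ℤ → Module.End R V)
    (ha : IsWeakVertexOperator a) (hb : IsWeakVertexOperator b)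
    (hc : IsWeakVertexOperator c)
    (hab : ∃ N : ℕ, IsMutuallyLocal (fun m w => a m w) (fun m w => b m w) N)
    (hac : ∃ N : ℕ, IsMutuallyLocal (fun m w => a m w) (fun m w => c m w) N)
    (hbc : ∃ N : ℕ, IsMutuallyLocal (fun m w => b m w) (fun m w => c m w) N)
    (n : ℤ) :
    ∃ N : ℕ, IsMutuallyLocal (resProd a b n) (fun m w => c m w) N := by
  obtain ⟨N, hab⟩ := hab
  obtain ⟨N₁, hac⟩ := hac
  obtain ⟨N₂, hbc⟩ := hbc
  refine ⟨N₂ + (N₁ + (N + (-n).toNat)), fun p q w => ?_⟩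
  obtain ⟨A, B, hA, hB, hA', hB', hD⟩ := resProd_commutator ha hb c w
  have hAB : ((shiftEnd V ((1, 0, 0) : ℤ × ℤ × ℤ) - shiftEnd V ((0, 1, 0) : ℤ × ℤ × ℤ)) ^ N)
      (A - B) = 0 := by
    funext x
    obtain ⟨p, q, k⟩ := x
    rw [shiftEnd_sub_pow_apply]
    have h₁ := hab p q (c k w)
    have h₂ := congrArg (c k) (hab p q w)
    rw [map_sum, map_zero] at h₂
    rw [Pi.zero_apply, ← sub_zero (0 : V)]
    nth_rw 2 [← h₂]
    rw [← h₁, ← Finset.sum_sub_distrib]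
    refine Finset.sum_congr rfl fun i _ => ?_
    rw [map_zsmul, ← smul_sub, map_sub]
    simp only [Pi.sub_apply, Prod.smul_mk, Prod.mk_add_mk, smul_zero, add_zero, zsmul_one,
      Int.cast_id, hA, hB, ← add_sub_assoc]
    congr 1
    abel
  have hA0 : ((shiftEnd V ((1, 0, 0) : ℤ × ℤ × ℤ) - shiftEnd V ((0, 0, 1) : ℤ × ℤ × ℤ)) ^ N₁)
      (((shiftEnd V ((0, 1, 0) : ℤ × ℤ × ℤ) - shiftEnd V ((0, 0, 1) : ℤ × ℤ × ℤ)) ^ N₂) A) = 0 :=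
    shiftEnd_sub_pow_commutator_eq_zero hac hbc w id (fun x s t => by ext <;> simp)
      (fun x s t => by ext <;> simp) fun x => hA _ _ _
  have hB0 : ((shiftEnd V ((1, 0, 0) : ℤ × ℤ × ℤ) - shiftEnd V ((0, 0, 1) : ℤ × ℤ × ℤ)) ^ N₁)
      (((shiftEnd V ((0, 1, 0) : ℤ × ℤ × ℤ) - shiftEnd V ((0, 0, 1) : ℤ × ℤ × ℤ)) ^ N₂) B) =
        0 := by
    rw [← Module.End.mul_apply, ((shiftEnd_sub_commute _ _ _ _).pow_pow _ _).eq,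
      Module.End.mul_apply]
    exact shiftEnd_sub_pow_commutator_eq_zero hbc hac w (fun x => (x.2.1, x.1, x.2.2))
      (fun x s t => by ext <;> simp) (fun x s t => by ext <;> simp) fun x => hB _ _ _
  have key := congrFun (shiftEnd_sub_pow_eq_zero hA' hB' hAB hA0 hB0 n) (0, p, q)
  rw [shiftEnd_sub_pow_apply, Pi.zero_apply] at key
  rw [← key]
  refine Finset.sum_congr rfl fun i _ => ?_
  rw [hD]
  refine congrArg _ (congrArg _ ?_)
  ext <;> simp [add_sub_assoc]
end

section
/- The residue product preserves the derivation property (Lemma 3.3): let a, b be weak vertex operators on V and T ∈ End_R(V) such that T∘a_m - a_m∘T = -m·a_{m-1} and T∘b_m - b_m∘T = -m·b_{m-1} for all m ∈ ℤ (the coefficient form of [T, a(z)] = (d/dz)a(z)). Then for all n, m ∈ ℤ one has T∘(a·ₙb)_m - (a·ₙb)_m∘T = -m·(a·ₙb)_{m-1}. -/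
/-!
Lemma 3.3: the residue product preserves the derivation property
`[T, a(z)] = (d/dz) a(z)`.
-/

variable {R V : Type*} [CommRing R] [AddCommGroup V] [Module R V]

/-- The coefficients `(-1)^i C(n,i)` satisfy a first-order recurrence in `i`. -/
theorem succ_mul_negOnePow_mul_choose (n : ℤ) (i : ℕ) :
    ((i : ℤ) + 1) * ((-1) ^ (i + 1) * Ring.choose n (i + 1))
      = ((i : ℤ) - n) * ((-1) ^ i * Ring.choose n i) := by
  have h := Ring.choose_smul_choose n (Nat.le_succ i)
  simp only [Nat.succ_eq_add_one, Nat.choose_succ_self_right, add_tsub_cancel_left,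
    Ring.choose_one_right, nsmul_eq_mul, Nat.cast_add, Nat.cast_one] at h
  linear_combination (-1 : ℤ) ^ (i + 1) * h

/-- For all large `K`, the residue product on a given vector is its `K`-th partial sum. -/
theorem exists_forall_resProd_eq_sum_range {a b : ℤ → Module.End R V}
    (ha : IsWeakVertexOperator a) (hb : IsWeakVertexOperator b) (n m : ℤ) (w : V) :
    ∃ N : ℕ, ∀ K : ℕ, N ≤ K → resProd a b n m w =
      ∑ i ∈ Finset.range K, ((-1 : ℤ) ^ i * Ring.choose n i) •
        (a (n - i) (b (m + i) w) - (n.negOnePow : ℤ) • b (n + m - i) (a i w)) := by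
  obtain ⟨A, hA⟩ := ha w
  obtain ⟨B, hB⟩ := hb w
  refine ⟨A.toNat + (B - m).toNat, fun K hK => ?_⟩
  refine finsum_eq_sum_of_support_subset _ fun i hi => ?_
  by_contra hiK
  simp only [Finset.coe_range, Set.mem_Iio, not_lt] at hiK
  apply hi
  simp only [hA i (by omega), hB (m + i) (by omega), map_zero, smul_zero, sub_zero]

/-- **Lemma 3.3.** If `T` satisfies `[T, aₘ] = -m a_{m-1}` and `[T, bₘ] = -m b_{m-1}`
(the coefficient form of `[T, a(z)] = (d/dz) a(z)`), then the residue product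
satisfies `[T, (a·ₙb)ₘ] = -m (a·ₙb)_{m-1}` for all `n, m ∈ ℤ`. -/
theorem resProd_derivation (a b : ℤ → Module.End R V)
    (ha : IsWeakVertexOperator a) (hb : IsWeakVertexOperator b)
    (T : Module.End R V)
    (hTa : ∀ m : ℤ, T * a m - a m * T = (-m : ℤ) • a (m - 1))
    (hTb : ∀ m : ℤ, T * b m - b m * T = (-m : ℤ) • b (m - 1)) :
    ∀ n m : ℤ, ∀ w : V,
      T (resProd a b n m w) - resProd a b n m (T w)
        = (-m : ℤ) • resProd a b n (m - 1) w := by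
  intro n m w
  obtain ⟨A, hA⟩ := ha w
  obtain ⟨B, hB⟩ := hb w
  obtain ⟨N₁, h₁⟩ := exists_forall_resProd_eq_sum_range ha hb n m w
  obtain ⟨N₂, h₂⟩ := exists_forall_resProd_eq_sum_range ha hb n m (T w)
  obtain ⟨N₃, h₃⟩ := exists_forall_resProd_eq_sum_range ha hb n (m - 1) w
  set K := N₁ + N₂ + N₃ + A.toNat + (B - m).toNat + 1 with hK
  rw [h₁ K (by omega), h₂ K (by omega), h₃ K (by omega)]
  have hTa' (k : ℤ) (v : V) : T (a k v) = a k (T v) - k • a (k - 1) v := by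
    have h := LinearMap.congr_fun (hTa k) v
    simp only [LinearMap.sub_apply, Module.End.mul_apply, LinearMap.smul_apply] at h
    rw [sub_eq_iff_eq_add.mp h]
    module
  have hTb' (k : ℤ) (v : V) : T (b k v) = b k (T v) - k • b (k - 1) v := by
    have h := LinearMap.congr_fun (hTb k) v
    simp only [LinearMap.sub_apply, Module.End.mul_apply, LinearMap.smul_apply] at h
    rw [sub_eq_iff_eq_add.mp h]
    module
  -- The difference of the two sides telescopes along `G`.
  let G : ℕ → V := fun i => ((i : ℤ) * ((-1 : ℤ) ^ i * Ring.choose n i)) •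
    (a (n - i) (b (m + i - 1) w) - (n.negOnePow : ℤ) • b (n + m - i) (a (i - 1) w))
  have hG₀ : G 0 = 0 := by simp [G]
  have hGK : G K = 0 := by
    simp only [G, hA (K - 1) (by omega), hB (m + K - 1) (by omega), map_zero, smul_zero, sub_zero]
  rw [← sub_eq_zero, map_sum, Finset.smul_sum, ← Finset.sum_sub_distrib,
    ← Finset.sum_sub_distrib]
  trans ∑ i ∈ Finset.range K, (G (i + 1) - G i)
  · refine Finset.sum_congr rfl fun i _ => ?_
    simp only [G, Nat.cast_add, Nat.cast_one, succ_mul_negOnePow_mul_choose, map_zsmul, map_sub,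
      hTa', hTb']
    rw [show n - ((i : ℤ) + 1) = n - i - 1 by ring, show m + ((i : ℤ) + 1) - 1 = m + i by ring,
      show n + m - ((i : ℤ) + 1) = n + m - i - 1 by ring, show (i : ℤ) + 1 - 1 = i by ring,
      show m - 1 + (i : ℤ) = m + i - 1 by ring,
      show n + (m - 1) - (i : ℤ) = n + m - i - 1 by ring]
    module
  · rw [Finset.sum_range_sub, hG₀, hGK, sub_zero]
end
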